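/- The metric g determined by the real constants a, b, p, q, s belongs to Gray's class 𝒜 (its Ricci tensor is cyclic-parallel, i.e. ∇_i ρ_{jk} + ∇_j ρ_{ki} + ∇_k ρ_{ij} = 0 for all indices i,j,k at every point of ℝ⁴, equivalently ρ is a Killing tensor) if and only if b = −a. -/

import Mathlib

noncomputable section

open scoped BigOperators

/-- The metric of a four-dimensional two-symmetric Lorentzian manifold, in
coordinates `x 0 = x¹, x 1 = x², x 2 = x³, x 3 = x⁴`:
`g₁₄ = g₄₁ = g₂₂ = g₃₃ = 1`,
`g₄₄ = x⁴(a(x²)² + b(x³)²) + p(x²)² + 2q x²x³ + s(x³)²`, all others zero. -/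
def gmat (a b p q s : ℝ) (x : Fin 4 → ℝ) : Matrix (Fin 4) (Fin 4) ℝ :=
  Matrix.of fun i j =>
    if i = 0 ∧ j = 3 then 1
    else if i = 3 ∧ j = 0 then 1
    else if i = 1 ∧ j = 1 then 1
    else if i = 2 ∧ j = 2 then 1
    else if i = 3 ∧ j = 3 then
      x 3 * (a * (x 1) ^ 2 + b * (x 2) ^ 2) + p * (x 1) ^ 2
        + 2 * q * x 1 * x 2 + s * (x 2) ^ 2
    else 0

/-- The inverse matrix `g^{ij}`. -/
def ginv (a b p q s : ℝ) (x : Fin 4 → ℝ) : Matrix (Fin 4) (Fin 4) ℝ :=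
  (gmat a b p q s x)⁻¹

/-- Partial derivative `∂_i` of a function on ℝ⁴. -/
def pd (i : Fin 4) (f : (Fin 4 → ℝ) → ℝ) (x : Fin 4 → ℝ) : ℝ :=
  fderiv ℝ f x (Pi.single i 1)

/-- Christoffel symbols `Γ^k_{ij} = (1/2) Σ_l g^{kl}(∂_i g_{jl} + ∂_j g_{il} − ∂_l g_{ij})`. -/
def Gam (a b p q s : ℝ) (k i j : Fin 4) (x : Fin 4 → ℝ) : ℝ :=
  (1 / 2) * ∑ l, ginv a b p q s x k l *
    (pd i (fun y => gmat a b p q s y j l) x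
      + pd j (fun y => gmat a b p q s y i l) x
      - pd l (fun y => gmat a b p q s y i j) x)

/-- Curvature tensor
`R^i_{jkl} = ∂_k Γ^i_{lj} − ∂_l Γ^i_{kj} + Σ_m (Γ^i_{km} Γ^m_{lj} − Γ^i_{lm} Γ^m_{kj})`. -/
def Riem (a b p q s : ℝ) (i j k l : Fin 4) (x : Fin 4 → ℝ) : ℝ :=
  pd k (Gam a b p q s i l j) x - pd l (Gam a b p q s i k j) x
    + ∑ m, (Gam a b p q s i k m x * Gam a b p q s m l j x
      - Gam a b p q s i l m x * Gam a b p q s m k j x)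

/-- Ricci tensor `ρ_{jl} = Σ_i R^i_{jil}`. -/
def Ric (a b p q s : ℝ) (j l : Fin 4) (x : Fin 4 → ℝ) : ℝ :=
  ∑ i, Riem a b p q s i j i l x

/-- Covariant derivative of the Ricci tensor
`∇_i ρ_{jk} = ∂_i ρ_{jk} − Σ_l (Γ^l_{ij} ρ_{lk} + Γ^l_{ik} ρ_{jl})`. -/
def covRic (a b p q s : ℝ) (i j k : Fin 4) (x : Fin 4 → ℝ) : ℝ :=
  pd i (Ric a b p q s j k) x
    - ∑ l, (Gam a b p q s l i j x * Ric a b p q s l k x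
      + Gam a b p q s l i k x * Ric a b p q s j l x)

/-- The gradient of the component `g₄₄`. -/
def gradH (a b p q s : ℝ) (x : Fin 4 → ℝ) : Fin 4 → ℝ :=
  ![0, 2 * a * x 3 * x 1 + 2 * p * x 1 + 2 * q * x 2,
    2 * b * x 3 * x 2 + 2 * q * x 1 + 2 * s * x 2, a * x 1 ^ 2 + b * x 2 ^ 2]

/-- The Hessian of the component `g₄₄`. -/
def hessH (a b p q s : ℝ) (x : Fin 4 → ℝ) : Fin 4 → Fin 4 → ℝ :=
  ![![0, 0, 0, 0],
    ![0, 2 * a * x 3 + 2 * p, 2 * q, 2 * a * x 1],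
    ![0, 2 * q, 2 * b * x 3 + 2 * s, 2 * b * x 2],
    ![0, 2 * a * x 1, 2 * b * x 2, 0]]

/-- The Christoffel symbols `Γ^k_{ij}` as a linear function of the gradient `v` of `g₄₄`. -/
def gamOfGrad (v : Fin 4 → ℝ) (k i j : Fin 4) : ℝ :=
  if k = 0 then
    if i = 3 ∧ j = 3 then v 3 / 2 else if i = 3 then v j / 2 else if j = 3 then v i / 2 else 0
  else if k = 3 then 0 else if i = 3 ∧ j = 3 then -(v k / 2) else 0

lemma pd_const (i : Fin 4) (c : ℝ) (x : Fin 4 → ℝ) : pd i (fun _ => c) x = 0 := by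
  simp [pd]

lemma pd_coord (i j : Fin 4) (x : Fin 4 → ℝ) :
    pd i (fun y => y j) x = if j = i then 1 else 0 := by
  unfold pd
  rw [(hasFDerivAt_apply (𝕜 := ℝ) j x).fderiv]
  simp [Pi.single_apply]

lemma pd_add (i : Fin 4) {f g : (Fin 4 → ℝ) → ℝ} {x : Fin 4 → ℝ}
    (hf : DifferentiableAt ℝ f x) (hg : DifferentiableAt ℝ g x) :
    pd i (fun y => f y + g y) x = pd i f x + pd i g x := by
  simp [pd, fderiv_fun_add hf hg]

lemma pd_mul (i : Fin 4) {f g : (Fin 4 → ℝ) → ℝ} {x : Fin 4 → ℝ}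
    (hf : DifferentiableAt ℝ f x) (hg : DifferentiableAt ℝ g x) :
    pd i (fun y => f y * g y) x = f x * pd i g x + g x * pd i f x := by
  simp [pd, fderiv_fun_mul hf hg]

lemma pd_neg (i : Fin 4) (f : (Fin 4 → ℝ) → ℝ) (x : Fin 4 → ℝ) :
    pd i (fun y => -f y) x = -pd i f x := by
  simp [pd, fderiv_fun_neg]

lemma pd_div_const (i : Fin 4) {f : (Fin 4 → ℝ) → ℝ} {x : Fin 4 → ℝ}
    (hf : DifferentiableAt ℝ f x) (c : ℝ) :
    pd i (fun y => f y / c) x = pd i f x / c := by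
  simp only [div_eq_mul_inv]
  rw [pd_mul i hf (differentiableAt_const _), pd_const]
  ring

lemma pd_gmat (a b p q s : ℝ) (l i j : Fin 4) (x : Fin 4 → ℝ) :
    pd l (fun y => gmat a b p q s y i j) x =
      if i = 3 ∧ j = 3 then gradH a b p q s x l else 0 := by
  by_cases h : i = 3 ∧ j = 3
  · obtain ⟨rfl, rfl⟩ := h
    simp only [gmat, Matrix.of_apply, sq]
    simp (disch := fun_prop) only [Fin.reduceEq, false_and, and_false, and_self, if_true,
      if_false, pd_add, pd_mul, pd_const, pd_coord]
    fin_cases l <;> simp [gradH] <;> ring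
  · simp only [gmat, Matrix.of_apply, h, if_false]
    split_ifs <;> exact pd_const _ _ _

lemma differentiableAt_gradH (a b p q s : ℝ) (i : Fin 4) (x : Fin 4 → ℝ) :
    DifferentiableAt ℝ (fun y => gradH a b p q s y i) x := by
  fin_cases i <;> simp [gradH] <;> fun_prop

lemma pd_gradH (a b p q s : ℝ) (l i : Fin 4) (x : Fin 4 → ℝ) :
    pd l (fun y => gradH a b p q s y i) x = hessH a b p q s x l i := by
  fin_cases i <;> simp [gradH, sq] <;>
    simp (disch := fun_prop) only [pd_add, pd_mul, pd_const, pd_coord] <;>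
    fin_cases l <;> simp [hessH] <;> ring

lemma ginv_eq (a b p q s : ℝ) (x : Fin 4 → ℝ) :
    ginv a b p q s x =
      !![-gmat a b p q s x 3 3, 0, 0, 1; 0, 1, 0, 0; 0, 0, 1, 0; 1, 0, 0, 0] := by
  refine Matrix.inv_eq_right_inv ?_
  ext i j
  fin_cases i <;> fin_cases j <;> simp [Matrix.mul_apply, Fin.sum_univ_four, gmat] <;> ring

lemma Gam_eq (a b p q s : ℝ) (k i j : Fin 4) :
    Gam a b p q s k i j = fun x => gamOfGrad (gradH a b p q s x) k i j := by
  funext x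
  simp only [Gam, pd_gmat, ginv_eq, Fin.sum_univ_four]
  fin_cases k <;> fin_cases i <;> fin_cases j <;> simp [gamOfGrad, gradH] <;> ring

lemma pd_Gam (a b p q s : ℝ) (l k i j : Fin 4) (x : Fin 4 → ℝ) :
    pd l (Gam a b p q s k i j) x = gamOfGrad (hessH a b p q s x l) k i j := by
  rw [Gam_eq]
  unfold gamOfGrad
  split_ifs <;>
    simp only [pd_const, pd_neg, pd_div_const _ (differentiableAt_gradH _ _ _ _ _ _ _), pd_gradH]

lemma Ric_eq (a b p q s : ℝ) (j l : Fin 4) :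
    Ric a b p q s j l =
      fun x => if j = 3 ∧ l = 3 then -((a + b) * x 3 + (p + s)) else 0 := by
  funext x
  simp only [Ric, Riem, pd_Gam]
  simp only [Gam_eq, Fin.sum_univ_four]
  fin_cases j <;> fin_cases l <;> simp [gamOfGrad, gradH, hessH] <;> ring

lemma covRic_eq (a b p q s : ℝ) (i j k : Fin 4) (x : Fin 4 → ℝ) :
    covRic a b p q s i j k x = if i = 3 ∧ j = 3 ∧ k = 3 then -(a + b) else 0 := by
  have hpd : pd i (Ric a b p q s j k) x = if i = 3 ∧ j = 3 ∧ k = 3 then -(a + b) else 0 := by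
    rw [Ric_eq]
    by_cases h : j = 3 ∧ k = 3
    · simp only [h, and_self, and_true, if_true]
      simp (disch := fun_prop) only [pd_neg, pd_add, pd_mul, pd_const, pd_coord]
      by_cases hi : i = 3 <;> simp [hi, eq_comm]
    · simp [h, pd_const]
  have hGam (i j : Fin 4) : Gam a b p q s 3 i j x = 0 := by simp [Gam_eq, gamOfGrad]
  rw [covRic, hpd, Fin.sum_univ_four]
  simp [hGam, Ric_eq]

/-- `g` belongs to Gray's class 𝒜 (the Ricci tensor is cyclic-parallel)
iff `b = −a`. -/
theorem class_A_iff (a b p q s : ℝ) :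
    (∀ (x : Fin 4 → ℝ) (i j k : Fin 4),
      covRic a b p q s i j k x + covRic a b p q s j k i x + covRic a b p q s k i j x = 0)
      ↔ b = -a := by
  simp only [covRic_eq]
  constructor
  · intro h
    have := h 0 3 3 3
    simp only [and_self, if_true] at this
    linarith
  · rintro rfl x i j k
    simp
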